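/- arXiv:2205.14537 — 2 statements merged into one kernel-verified Lean document; each statement's English description precedes it below -/
import Mathlib

section
/- For every integer d ≥ 2, the function z ↦ z·( ((d+2)·d!/4)·R₁(z)·z^{−(d/2+1)} − 1 ) − (d(d+2)/12)·( d − 2 + 6·(1/4 − ψ(w(z))²) ) tends to 0 as z → +∞, where w(z) = ((1−d) + √((d−1)² + 4z))/2 is the unique nonnegative solution of w(w+d−1) = z. -/
/-- Multiplicity of the eigenvalue `l(l+d−1)` of the Laplacian on the `d`-sphere:
`m_{l,d} = C(d+l, l) − C(d+l−2, l−2)`, the second term being `0` for `l < 2`. -/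
noncomputable def sphereMult (d l : ℕ) : ℝ :=
  (Nat.choose (d + l) l : ℝ) - if 2 ≤ l then (Nat.choose (d + l - 2) (l - 2) : ℝ) else 0

/-- First Riesz-mean of the Laplacian eigenvalues on the `d`-sphere. -/
noncomputable def R1Sd (d : ℕ) (z : ℝ) : ℝ :=
  ∑' l : ℕ, sphereMult d l * max (z - (l : ℝ) * ((l : ℝ) + (d : ℝ) - 1)) 0

/-- The fluctuation function `ψ(η) = η − ⌊η⌋ − 1/2`. -/
noncomputable def psi (η : ℝ) : ℝ := η - (⌊η⌋ : ℝ) - 1 / 2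

/-- The unique nonnegative solution `w` of `w(w+d−1) = z`. -/
noncomputable def wvar (d : ℕ) (z : ℝ) : ℝ :=
  ((1 - (d : ℝ)) + Real.sqrt (((d : ℝ) - 1) ^ 2 + 4 * z)) / 2

open Filter Topology

lemma qexp (n : ℕ) : ∃ q : ℝ → ℝ, Continuous q ∧ q 1 = n * (n - 1) / 2 ∧
    ∀ t, t ^ n = 1 + n * (t - 1) + (t - 1) ^ 2 * q t := by
  induction n with
  | zero => exact ⟨fun _ => 0, continuous_const, by simp, by simp⟩
  | succ n ih =>
    obtain ⟨q, hc, h1, h⟩ := ih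
    refine ⟨fun t => t * q t + n, by fun_prop, ?_, ?_⟩
    · simp only [h1]; push_cast; ring
    · intro t
      rw [pow_succ, h]; push_cast; ring

/-- the symmetric product of length `n`, centred at `x` -/
noncomputable def symQ (n : ℕ) (x : ℝ) : ℝ :=
  ∏ i ∈ Finset.range n, (x - ((n : ℝ) - 1) / 2 + i)

lemma symQ_succ (n : ℕ) (x : ℝ) :
    symQ (n + 2) x = symQ n x * (x ^ 2 - ((n : ℝ) + 1) ^ 2 / 4) := by
  unfold symQ
  rw [Finset.prod_range_succ, Finset.prod_range_succ']
  have : ∀ i ∈ Finset.range n, (x - (((n + 2 : ℕ) : ℝ) - 1) / 2 + ((i + 1 : ℕ) : ℝ))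
      = (x - ((n : ℝ) - 1) / 2 + i) := by
    intro i _; push_cast; ring
  rw [Finset.prod_congr rfl this]
  push_cast; ring

lemma symQ_asymp (n : ℕ) :
    Tendsto (fun x : ℝ => x ^ 2 * (symQ n x / x ^ n - 1)) atTop
      (𝓝 (-(((n : ℝ) + 1) * n * (n - 1) / 24))) := by
  induction n using Nat.twoStepInduction with
  | zero => simp [symQ]
  | one =>
    refine Tendsto.congr' (f₁ := fun _ => 0) ?_ (by simp)
    filter_upwards [eventually_gt_atTop 0] with x hx
    simp [symQ, hx.ne']
  | more n ih _ =>
    have hb : Tendsto (fun x : ℝ => 1 - ((n : ℝ) + 1) ^ 2 / 4 * (x ^ 2)⁻¹) atTop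
        (𝓝 (1 - ((n : ℝ) + 1) ^ 2 / 4 * 0)) :=
      tendsto_const_nhds.sub (tendsto_const_nhds.mul
        (tendsto_inv_atTop_zero.comp (tendsto_pow_atTop two_ne_zero)))
    have h := (ih.mul hb).sub (tendsto_const_nhds (x := ((n : ℝ) + 1) ^ 2 / 4))
    have e : -(((n : ℝ) + 1) * n * (n - 1) / 24) * (1 - ((n : ℝ) + 1) ^ 2 / 4 * 0)
        - ((n : ℝ) + 1) ^ 2 / 4
        = -((((n + 2 : ℕ) : ℝ) + 1) * ((n + 2 : ℕ) : ℝ) * (((n + 2 : ℕ) : ℝ) - 1) / 24) := by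
      push_cast; ring
    rw [e] at h
    refine h.congr' ?_
    filter_upwards [eventually_gt_atTop 0] with x hx
    rw [symQ_succ]
    field_simp
    ring

/-- the product `(l+1)…(l+k)` -/
noncomputable def prodB (k l : ℕ) : ℝ := ((l + 1).ascFactorial k : ℝ)

lemma prodB_succ_mul (k l : ℕ) :
    ((l : ℝ) + 1) * prodB k (l + 1) = (l + k + 1) * prodB k l := by
  unfold prodB
  have h := Nat.succ_ascFactorial (l + 1) k
  have h' : ((l + 1 : ℕ) : ℝ) * ((l + 1 + 1).ascFactorial k : ℝ)
    = ((l + 1 + k : ℕ) : ℝ) * ((l + 1).ascFactorial k : ℝ) := by exact_mod_cast h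
  push_cast at h'
  rw [h']; ring

lemma prodB_succ (k l : ℕ) : prodB (k + 1) l = (l + k + 1) * prodB k l := by
  unfold prodB
  rw [Nat.ascFactorial_succ]; push_cast; ring

lemma choose_eq (d l : ℕ) : (Nat.choose (d + l) l : ℝ) * d.factorial = prodB d l := by
  unfold prodB
  have h := Nat.ascFactorial_eq_factorial_mul_choose l d
  rw [h, show d + l = l + d by ring, ← Nat.choose_symm_add]
  push_cast; ring

lemma mult_eq (k l : ℕ) : sphereMult (k + 2) l * (k + 2).factorial =
    prodB k l * (((l : ℝ) + k + 1) * (l + k + 2) - (l - 1) * l) := by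
  unfold sphereMult
  rw [sub_mul, choose_eq, prodB_succ, prodB_succ]
  rcases l with _ | _ | l
  · simp; ring
  · simp; ring
  · have : k + 2 + (l + 1 + 1) - 2 = (k + 2) + l := by omega
    rw [if_pos (by omega), this, show l + 1 + 1 - 2 = l by omega, choose_eq, prodB_succ, prodB_succ]
    have h1 := prodB_succ_mul k l
    have h2 := prodB_succ_mul k (l + 1)
    push_cast at h2 ⊢
    linear_combination (l + k + 2 : ℝ) * h1 + (l + 1 : ℝ) * h2

lemma partial_sum (k L : ℕ) (z : ℝ) :
    ((k : ℝ) + 4) * (k + 2).factorial * ∑ l ∈ Finset.range (L + 1),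
      sphereMult (k + 2) l * (z - (l : ℝ) * ((l : ℝ) + ((k + 2 : ℕ) : ℝ) - 1)) =
    (2 * L + k + 2) * (L + k + 1) * prodB k L * ((k + 4) * z - (k + 2) * L * (L + k + 2)) := by
  induction L with
  | zero =>
    have := mult_eq k 0
    simp at this ⊢
    linear_combination (k + 4 : ℝ) * z * this
  | succ L ih =>
    rw [Finset.sum_range_succ, mul_add, ih]
    have h1 := prodB_succ_mul k L
    have h2 := mult_eq k (L + 1)
    push_cast at h2 ⊢
    linear_combination (-(2 * L + k + 2 : ℝ)) * ((k + 4) * z - (k + 2) * L * (L + k + 2)) * h1 +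
      (k + 4 : ℝ) * (z - (L + 1) * (L + 1 + (k + 2) - 1)) * h2

lemma prodB_symQ (k L : ℕ) : ((L : ℝ) + k + 1) * prodB k L = symQ (k + 1) (L + ((k : ℝ) + 2) / 2) := by
  rw [← prodB_succ]
  unfold prodB symQ
  rw [Nat.ascFactorial_eq_prod_range]
  push_cast
  refine Finset.prod_congr rfl fun i _ => ?_
  ring

lemma wvar_sq (d : ℕ) {z : ℝ} (hz : 0 ≤ z) : wvar d z * (wvar d z + d - 1) = z := by
  unfold wvar
  have h := Real.sq_sqrt (show 0 ≤ ((d : ℝ) - 1) ^ 2 + 4 * z by positivity)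
  linear_combination h / 4

lemma wvar_nonneg (d : ℕ) {z : ℝ} (hz : 0 ≤ z) : 0 ≤ wvar d z := by
  unfold wvar
  have : (d : ℝ) - 1 ≤ √(((d : ℝ) - 1) ^ 2 + 4 * z) :=
    Real.le_sqrt_of_sq_le (by linarith)
  linarith

lemma R1_eq (k : ℕ) {z : ℝ} (hz : 0 ≤ z) :
    ((k : ℝ) + 4) * (k + 2).factorial * R1Sd (k + 2) z =
      (2 * ((⌊wvar (k + 2) z⌋₊ : ℝ) + (k + 2) / 2)) *
        symQ (k + 1) ((⌊wvar (k + 2) z⌋₊ : ℝ) + (k + 2) / 2) *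
        ((k + 4) * z - (k + 2) * ((⌊wvar (k + 2) z⌋₊ : ℝ) + (k + 2) / 2) ^ 2 + (k + 2) ^ 3 / 4) := by
  have hw := wvar_sq (k + 2) hz
  have hw0 := wvar_nonneg (k + 2) hz
  set w := wvar (k + 2) z with hwdef
  set L := ⌊w⌋₊ with hL
  have e : R1Sd (k + 2) z = ∑ l ∈ Finset.range (L + 1),
      sphereMult (k + 2) l * (z - (l : ℝ) * ((l : ℝ) + ((k + 2 : ℕ) : ℝ) - 1)) := by
    unfold R1Sd
    rw [tsum_eq_sum (s := Finset.range (L + 1))]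
    · refine Finset.sum_congr rfl fun l hl => ?_
      rw [max_eq_left]
      have h1 : l ≤ L := by simpa [Nat.lt_succ_iff] using hl
      have h2 : (l : ℝ) ≤ w := (Nat.le_floor_iff hw0).1 h1
      have : 0 ≤ (w - l) * (w + l + k + 1) := mul_nonneg (by linarith) (by positivity)
      push_cast at hw ⊢
      nlinarith
    · intro l hl
      rw [max_eq_right, mul_zero]
      have h1 : L < l := by simpa [Nat.lt_succ_iff] using hl
      have h2 : w < l := (Nat.floor_lt hw0).1 h1
      have : 0 ≤ (l - w) * (w + l + k + 1) := mul_nonneg (by linarith) (by positivity)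
      push_cast at hw ⊢
      nlinarith
  rw [e, partial_sum, ← prodB_symQ]
  ring

lemma psi_abs (η : ℝ) : |psi η| ≤ 1 / 2 := by
  unfold psi
  have h1 := Int.floor_le η
  have h2 := Int.lt_floor_add_one η
  rw [abs_le]; constructor <;> linarith

theorem riesz_mean_sphere_two_term_asymptotics (d : ℕ) (hd : 2 ≤ d) :
    Filter.Tendsto
      (fun z : ℝ =>
        z * (((d : ℝ) + 2) * (Nat.factorial d : ℝ) / 4 * R1Sd d z *
              z ^ (-((d : ℝ) / 2 + 1)) - 1) -
          ((d : ℝ) * ((d : ℝ) + 2) / 12) *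
            ((d : ℝ) - 2 + 6 * (1 / 4 - psi (wvar d z) ^ 2)))
      Filter.atTop (nhds 0) := by
  obtain ⟨k, rfl⟩ : ∃ k, d = k + 2 := ⟨d - 2, by omega⟩
  set X : ℝ → ℝ := fun z => (⌊wvar (k + 2) z⌋₊ : ℝ) + (k + 2) / 2 with hX
  set p : ℝ → ℝ := fun z => psi (wvar (k + 2) z) with hp
  set u : ℝ → ℝ := fun z => √(((k : ℝ) + 1) ^ 2 + 4 * z) / 2 - √z with hu
  have hsT : Tendsto (fun z : ℝ => √z) atTop atTop := Real.tendsto_sqrt_atTop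
  have hu0 : Tendsto u atTop (𝓝 0) := by
    have hb : Tendsto (fun z : ℝ => ((k : ℝ) + 1) ^ 2 / 4 * (√z)⁻¹) atTop (𝓝 0) := by
      simpa using (tendsto_inv_atTop_zero.comp hsT).const_mul (((k : ℝ) + 1) ^ 2 / 4)
    refine tendsto_of_tendsto_of_tendsto_of_le_of_le' tendsto_const_nhds hb ?_ ?_
    · filter_upwards [eventually_gt_atTop 0] with z hz
      have h1 := Real.sq_sqrt hz.le
      have : 2 * √z ≤ √(((k : ℝ) + 1) ^ 2 + 4 * z) :=
        Real.le_sqrt_of_sq_le (by nlinarith [sq_nonneg ((k : ℝ) + 1)])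
      simp only [hu]; linarith
    · filter_upwards [eventually_gt_atTop 0] with z hz
      have h1 := Real.sq_sqrt hz.le
      have h0 := Real.sqrt_pos.2 hz
      have h2 := Real.sq_sqrt (show 0 ≤ ((k : ℝ) + 1) ^ 2 + 4 * z by positivity)
      have h3 := Real.sqrt_nonneg (((k : ℝ) + 1) ^ 2 + 4 * z)
      have h4 : 2 * √z ≤ √(((k : ℝ) + 1) ^ 2 + 4 * z) :=
        Real.le_sqrt_of_sq_le (by nlinarith [sq_nonneg ((k : ℝ) + 1)])
      simp only [hu]
      rw [← div_eq_mul_inv, le_div_iff₀ h0]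
      nlinarith
  have hXs : ∀ᶠ z in atTop, X z - √z = u z - p z := by
    filter_upwards [eventually_ge_atTop 0] with z hz
    have hw0 := wvar_nonneg (k + 2) hz
    have h1 : ((⌊wvar (k + 2) z⌋₊ : ℕ) : ℝ) = (⌊wvar (k + 2) z⌋ : ℝ) :=
      natCast_floor_eq_intCast_floor hw0
    simp only [hX, hp, hu, psi, h1]
    have h2 : wvar (k + 2) z = (-((k : ℝ) + 1) + √(((k : ℝ) + 1) ^ 2 + 4 * z)) / 2 := by
      unfold wvar; push_cast; ring_nf
    linear_combination h2
  have hpb : ∀ z, |p z| ≤ 1 / 2 := fun z => psi_abs _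
  have hub : ∀ᶠ z in atTop, |u z - p z| ≤ 1 := by
    filter_upwards [hu0.eventually (Metric.ball_mem_nhds 0 (show (0 : ℝ) < 1 / 2 by norm_num))] with z hz
    rw [Real.dist_eq, sub_zero] at hz
    have h1 := abs_lt.1 hz
    have h2 := abs_le.1 (hpb z)
    exact abs_le.2 ⟨by linarith [h1.1, h2.2], by linarith [h1.2, h2.1]⟩
  set t : ℝ → ℝ := fun z => X z / √z with ht
  have ht1 : Tendsto t atTop (𝓝 1) := by
    have h0 : Tendsto (fun z => (√z)⁻¹ * (u z - p z)) atTop (𝓝 0) := by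
      refine Tendsto.zero_mul_isBoundedUnder_le (tendsto_inv_atTop_zero.comp hsT) ?_
      exact isBoundedUnder_of_eventually_le (a := 1) (by simpa using hub)
    have h1 := h0.const_add 1
    rw [add_zero] at h1
    refine h1.congr' ?_
    filter_upwards [hXs, eventually_gt_atTop 0] with z hz hz0
    have := Real.sqrt_pos.2 hz0
    rw [← hz, ht]; field_simp; ring
  have hXT : Tendsto X atTop atTop := by
    have h := tendsto_atTop_add_const_right atTop (-1 : ℝ) hsT
    refine tendsto_atTop_mono' _ ?_ h
    filter_upwards [hXs, hub] with z h1 h2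
    have := (abs_le.1 h2).1
    linarith
  have hA := (symQ_asymp (k + 1)).comp hXT
  set a : ℝ → ℝ := fun z => symQ (k + 1) (X z) / X z ^ (k + 1) with ha
  obtain ⟨q1, hq1c, hq11, hq1⟩ := qexp (k + 2)
  obtain ⟨q2, hq2c, hq21, hq2⟩ := qexp (k + 4)
  set h : ℝ → ℝ := fun x => ((k + 4) * q1 x - (k + 2) * q2 x) / 2 with hh
  have hhc : Continuous h := by fun_prop
  have hh1 : h 1 = -((k : ℝ) + 2) * (k + 4) / 2 := by
    simp only [hh, hq11, hq21]; push_cast; ring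
  have hg : ∀ x, x ^ (k + 2) * ((k + 4) - (k + 2) * x ^ 2) / 2 = 1 + (x - 1) ^ 2 * h x := by
    intro x
    have e1 := hq1 x
    have e2 := hq2 x
    simp only [hh]
    push_cast at e1 e2
    linear_combination ((k : ℝ) + 4) / 2 * e1 - ((k : ℝ) + 2) / 2 * e2
  -- first piece
  have hza : Tendsto (fun z => z * (a z - 1)) atTop
      (𝓝 (-(((k : ℝ) + 2) * (k + 1) * k / 24))) := by
    have h1 := hA.div (ht1.pow 2) (by norm_num)
    have e : -((((k + 1 : ℕ) : ℝ) + 1) * ((k + 1 : ℕ) : ℝ) * (((k + 1 : ℕ) : ℝ) - 1) / 24) / 1 ^ 2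
      = -(((k : ℝ) + 2) * (k + 1) * k / 24) := by push_cast; ring
    rw [e] at h1
    refine h1.congr' ?_
    filter_upwards [eventually_gt_atTop 0, hXT.eventually_gt_atTop 0] with z hz hx
    have h3 := Real.sqrt_pos.2 hz
    have h2 := Real.sq_sqrt hz.le
    simp only [Function.comp, Pi.div_apply, ht, ha]
    rw [div_pow, h2]
    field_simp
  have ha1 : Tendsto a atTop (𝓝 1) := by
    have h1 := (hza.mul tendsto_inv_atTop_zero).const_add 1
    rw [mul_zero, add_zero] at h1
    refine h1.congr' ?_
    filter_upwards [eventually_gt_atTop 0] with z hz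
    field_simp; ring
  have T1 : Tendsto (fun z => z * (a z - 1) * (1 + (t z - 1) ^ 2 * h (t z))) atTop
      (𝓝 (-(((k : ℝ) + 2) * (k + 1) * k / 24))) := by
    have h1 := hza.mul ((((ht1.sub_const 1).pow 2).mul ((hhc.tendsto 1).comp ht1)).const_add 1)
    simpa using h1
  have T3 : Tendsto (fun z => a z * t z ^ (k + 2) * (((k : ℝ) + 2) ^ 3 / 8)) atTop
      (𝓝 (((k : ℝ) + 2) ^ 3 / 8)) := by
    simpa using (ha1.mul (ht1.pow (k + 2))).mul_const (((k : ℝ) + 2) ^ 3 / 8)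
  have T2 : Tendsto (fun z => (h (t z) - h 1) * (u z - p z) ^ 2) atTop (𝓝 0) := by
    refine Tendsto.zero_mul_isBoundedUnder_le ?_ ?_
    · simpa using ((hhc.tendsto 1).comp ht1).sub_const (h 1)
    · refine isBoundedUnder_of_eventually_le (a := 1) ?_
      filter_upwards [hub] with z hz
      simp only [Function.comp, norm_pow, Real.norm_eq_abs]
      exact pow_le_one₀ (abs_nonneg _) hz
  have T4 : Tendsto (fun z => u z * (u z - 2 * p z)) atTop (𝓝 0) := by
    refine Tendsto.zero_mul_isBoundedUnder_le hu0 ?_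
    refine isBoundedUnder_of_eventually_le (a := 2) ?_
    filter_upwards [hub] with z hz
    simp only [Function.comp, Real.norm_eq_abs]
    have := hpb z
    rw [abs_le] at *
    constructor <;> linarith [hz.1, hz.2, this.1, this.2]
  have T := ((T1.add T3).add T2).add (T4.const_mul (h 1))
  have T' := T.sub_const (-(((k : ℝ) + 2) * (k + 1) * k / 24) + ((k : ℝ) + 2) ^ 3 / 8)
  have e0 : (-(((k : ℝ) + 2) * (k + 1) * k / 24) + ((k : ℝ) + 2) ^ 3 / 8 + 0 + h 1 * 0
    - (-(((k : ℝ) + 2) * (k + 1) * k / 24) + ((k : ℝ) + 2) ^ 3 / 8)) = 0 := by ring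
  rw [e0] at T'
  refine T'.congr' ?_
  filter_upwards [eventually_gt_atTop 0, hXT.eventually_gt_atTop 0, hXs] with z hz hx hxs
  have h3 := Real.sqrt_pos.2 hz
  have h2 := Real.sq_sqrt hz.le
  have hR := R1_eq k hz.le
  have hpow : z ^ (-((((k + 2 : ℕ) : ℝ)) / 2 + 1)) = (√z ^ (k + 4))⁻¹ := by
    rw [Real.rpow_neg hz.le, Real.sqrt_eq_rpow, ← Real.rpow_natCast, ← Real.rpow_mul hz.le]
    congr 2
    push_cast; ring
  have hR' : ((k : ℝ) + 4) * (k + 2).factorial * R1Sd (k + 2) z = 2 * X z * symQ (k + 1) (X z) *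
      ((k + 4) * z - (k + 2) * X z ^ 2 + (k + 2) ^ 3 / 4) := hR
  have hQ : symQ (k + 1) (X z) = a z * X z ^ (k + 1) := by
    simp only [ha]; field_simp
  have hXt : X z = t z * √z := by simp only [ht]; field_simp
  have key : z * ((((k + 2 : ℕ) : ℝ) + 2) * ((k + 2).factorial : ℝ) / 4 * R1Sd (k + 2) z *
      z ^ (-((((k + 2 : ℕ) : ℝ)) / 2 + 1)) - 1) =
      z * (a z - 1) * (t z ^ (k + 2) * ((k + 4) - (k + 2) * t z ^ 2) / 2)
      + a z * t z ^ (k + 2) * (((k : ℝ) + 2) ^ 3 / 8)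
      + z * (t z ^ (k + 2) * ((k + 4) - (k + 2) * t z ^ 2) / 2 - 1) := by
    rw [hpow]
    have : (((k + 2 : ℕ) : ℝ) + 2) * ((k + 2).factorial : ℝ) / 4 * R1Sd (k + 2) z =
      a z * X z ^ (k + 2) * ((k + 4) * z - (k + 2) * X z ^ 2 + (k + 2) ^ 3 / 4) / 2 := by
      rw [hQ] at hR'
      push_cast
      linear_combination hR' / 4
    rw [this, hXt]
    generalize √z = s at *
    generalize t z = τ at *
    rw [← h2]
    field_simp
    ring
  have hfin : z * (t z - 1) ^ 2 = (u z - p z) ^ 2 := by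
    rw [← hxs, hXt, ← h2, Real.sqrt_sq h3.le]; ring
  rw [key, hg]
  simp only [hh1]
  push_cast
  change _ = _ - ((k : ℝ) + 2) * ((k : ℝ) + 2 + 2) / 12 * ((k : ℝ) + 2 - 2 + 6 * (1 / 4 - p z ^ 2))
  linear_combination (-h (t z)) * hfin
end

section
/- For every integer d ≥ 3 and every real z ≥ 0, the first Riesz-mean of the biharmonic eigenvalues on the d-sphere satisfies R₁²(z) = ∑_{l=0}^∞ m_{l,d}·max(z − (l(l+d−1))², 0) ≥ (8/((d+4)·d!))·z^{1+d/4}. -/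
/-- First Riesz-mean of the biharmonic eigenvalues `(l(l+d−1))²` on the `d`-sphere. -/
noncomputable def R1biharmSd (d : ℕ) (z : ℝ) : ℝ :=
  ∑' l : ℕ, sphereMult d l * max (z - ((l : ℝ) * ((l : ℝ) + (d : ℝ) - 1)) ^ 2) 0


lemma bern_aux (p v : ℝ) (hp : 3/2 ≤ p) (hv : 0 < v) :
    v ^ p * (v + 2 * p * (p+1)) ≤ (v + 2*p) ^ (p+1) := by
  have h := one_add_mul_self_le_rpow_one_add (s := 2*p/v) (p := p+1)
    (by have : 0 ≤ 2*p/v := by positivity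
        linarith) (by linarith)
  have e : v + 2*p = v * (1 + 2*p/v) := by field_simp
  rw [e, Real.mul_rpow hv.le (by positivity)]
  calc v ^ p * (v + 2 * p * (p+1)) = v ^ (p+1) * (1 + (p+1) * (2*p/v)) := by
        rw [Real.rpow_add hv, Real.rpow_one]; field_simp
    _ ≤ _ := by gcongr

lemma bracket_aux (p x a v : ℝ) (hp : 3/2 ≤ p) (hx : x^2 = a + p*(p+1)) (ha : p + 1 ≤ a) :
    v^2 - a*(a+p)/(a+2*p) * (v + 2*p*(p+1))
      + (a+3*p)/(2*(a+2*p)) * ((p+1)*(x^2-(v-a)^2) - 2*(v-a)*v) ≤ 0 := by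
  have hpos : 0 < a + 2*p := by linarith
  have e : v^2 - a*(a+p)/(a+2*p) * (v + 2*p*(p+1))
      + (a+3*p)/(2*(a+2*p)) * ((p+1)*(x^2-(v-a)^2) - 2*(v-a)*v)
      = (((a+3*p)*(p+1)*(a+p*(p+1))/2 + p*a^2 - 2*p*(p+1)*a*(a+p))
        - ((a+3*p)*(p+3)/2 - (a+2*p)) * (v-a)^2) / (a+2*p) := by
    have hne : a + 2*p ≠ 0 := hpos.ne'
    rw [hx]
    generalize hD : a + 2*p = D at hne ⊢
    obtain rfl : a = D - 2*p := by linarith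
    field_simp
    ring
  rw [e]
  apply div_nonpos_of_nonpos_of_nonneg _ hpos.le
  have h1 : 0 ≤ ((a+3*p)*(p+3)/2 - (a+2*p)) := by nlinarith
  have h2 : (a+3*p)*(p+1)*(a+p*(p+1))/2 + p*a^2 - 2*p*(p+1)*a*(a+p) ≤ 0 := by
    obtain ⟨q, rfl⟩ : ∃ q, p = q + 3/2 := ⟨p - 3/2, by ring⟩
    obtain ⟨b, rfl⟩ : ∃ b, a = b + (q + 3/2 + 1) := ⟨a - (q+3/2+1), by ring⟩
    have hq : 0 ≤ q := by linarith
    have hb : 0 ≤ b := by linarith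
    rw [← neg_nonneg]
    ring_nf
    positivity
  nlinarith [mul_nonneg h1 (sq_nonneg (v-a))]

lemma step_aux (p x a : ℝ) (hp : 3/2 ≤ p) (hx : x^2 = a + p*(p+1)) (ha : p + 1 ≤ a)
    (hx0 : 0 ≤ x) (hxa : x ≤ a) :
    (a+x)^(p+3) - (a-x)^(p+3) ≤
      (p+3) * (a*(a+p)/(a+2*p)/(p+2)) * ((a+2*p+x)^(p+2) - (a+2*p-x)^(p+2)) := by
  set κ := a*(a+p)/(a+2*p) with hκ
  set α := (a+3*p)/(2*(a+2*p)) with hα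
  have hκ0 : 0 ≤ κ := by
    have : 0 < a := by linarith
    positivity
  let H : ℝ → ℝ := fun v => v^(p+3)/(p+3) - κ * ((v+2*p)^(p+2)/(p+2))
    + α * (v^(p+1) * (x^2 - (v-a)^2))
  have hanti : AntitoneOn H (Set.Icc (a-x) (a+x)) := by
    apply antitoneOn_of_hasDerivWithinAt_nonpos (convex_Icc _ _)
      (f' := fun v => v^(p+2) - κ * (v+2*p)^(p+1)
        + α * ((p+1) * v^p * (x^2 - (v-a)^2) + v^(p+1) * (-(2*(v-a)))))
    · apply ContinuousOn.add
      · apply ContinuousOn.sub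
        · apply ContinuousOn.div_const
          exact (Real.continuous_rpow_const (by linarith)).continuousOn
        · apply ContinuousOn.mul continuousOn_const
          apply ContinuousOn.div_const
          exact ((Real.continuous_rpow_const (q := p+2) (by linarith)).comp
            (continuous_id.add continuous_const)).continuousOn
      · apply ContinuousOn.mul continuousOn_const
        apply ContinuousOn.mul
        · exact (Real.continuous_rpow_const (by linarith)).continuousOn
        · fun_prop
    · intro v hv
      rw [interior_Icc] at hv
      have hv0 : 0 < v := by linarith [hv.1]
      apply HasDerivAt.hasDerivWithinAt
      have d1 := (Real.hasDerivAt_rpow_const (x := v) (p := p+3) (Or.inl hv0.ne')).div_const (p+3)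
      have d2 := ((((hasDerivAt_id v).add_const (2*p)).rpow_const (p := p+2)
        (Or.inl (by simp only [id]; linarith))).div_const (p+2)).const_mul κ
      have d3 := ((Real.hasDerivAt_rpow_const (x := v) (p := p+1) (Or.inl hv0.ne')).mul
        ((((hasDerivAt_id v).sub_const a).pow 2).const_sub (x^2))).const_mul α
      have D : HasDerivAt H _ v := (d1.sub d2).add d3
      refine D.congr_deriv ?_
      have e1 : p + 3 - 1 = p + 2 := by ring
      have e2 : p + 2 - 1 = p + 1 := by ring
      have e3 : p + 1 - 1 = p := by ring
      have n1 : p + 3 ≠ 0 := by linarith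
      have n2 : p + 2 ≠ 0 := by linarith
      simp only [id, e1, e2, e3, Pi.pow_apply]
      field_simp
      push_cast
      ring
    · intro v hv
      rw [interior_Icc] at hv
      have hv0 : 0 < v := by linarith [hv.1]
      have hb := bern_aux p v hp hv0
      have hbr := bracket_aux p x a v hp hx ha
      rw [← hκ, ← hα] at hbr
      have hvp : 0 ≤ v^p := by positivity
      have e2 : v^(p+2) = v^p * v^2 := by
        rw [Real.rpow_add hv0]; norm_num
      have e1 : v^(p+1) = v^p * v := by
        rw [Real.rpow_add hv0, Real.rpow_one]
      simp only [e2, e1]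
      have := mul_le_mul_of_nonneg_left hb hκ0
      have := mul_nonpos_of_nonneg_of_nonpos hvp hbr
      nlinarith
  have h := hanti (Set.left_mem_Icc.2 (by linarith)) (Set.right_mem_Icc.2 (by linarith))
    (by linarith : a - x ≤ a + x)
  simp only [H] at h
  have z1 : x^2 - (a + x - a)^2 = 0 := by ring
  have z2 : x^2 - (a - x - a)^2 = 0 := by ring
  have z3 : a + x + 2*p = a + 2*p + x := by ring
  have z4 : a - x + 2*p = a + 2*p - x := by ring
  rw [z1, z2, z3, z4] at h
  have hp3 : 0 < p + 3 := by linarith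
  have hp2 : 0 < p + 2 := by linarith
  have := mul_le_mul_of_nonneg_left h hp3.le
  have c1 : ∀ y : ℝ, (p+3) * (y/(p+3)) = y := fun y => by field_simp
  simp only [mul_sub, c1, mul_zero, add_zero] at this
  have c2 : (p+3) * (κ/(p+2)) * ((a+2*p+x)^(p+2) - (a+2*p-x)^(p+2))
    = (p+3) * (κ * ((a+2*p+x)^(p+2)/(p+2))) - (p+3)*(κ * ((a+2*p-x)^(p+2)/(p+2))) := by ring
  rw [c2]
  linarith

noncomputable def PP (d l : ℕ) : ℝ :=
  (2*(l:ℝ)+d) * ((l+d-1).factorial : ℝ) / (2 * (l.factorial : ℝ))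

def Key (d : ℕ) : Prop := ∀ l : ℕ,
  (((l:ℝ)+1)*((l:ℝ)+1+d-1)) ^ ((d:ℝ)/2+2) - ((l:ℝ)*((l:ℝ)+d-1)) ^ ((d:ℝ)/2+2)
    ≤ ((d:ℝ)/2+2) * (2 * ((l:ℝ)^2+d*l+d/2) * (l+d/2)) * PP d l

lemma key_step (d : ℕ) (hd : 3 ≤ d) (h : Key d) : Key (d+2) := by
  intro l
  have hd' : (3:ℝ) ≤ d := by exact_mod_cast hd
  have hl : (0:ℝ) ≤ l := by positivity
  have h1 := h (l+1)
  set p : ℝ := (d:ℝ)/2 with hp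
  have hdp : (d:ℝ) = 2*p := by rw [hp]; ring
  set x : ℝ := l + p + 1 with hx
  set a : ℝ := x^2 - p*(p+1) with ha
  have hpa : p + 1 ≤ a := by nlinarith
  have hxa : x ≤ a := by nlinarith
  have s := step_aux p x a (by linarith) (by rw [ha]; ring) hpa (by linarith) hxa
  have hP : PP (d+2) l = (a + p) * PP d (l+1) := by
    have e : l + (d+2) - 1 = (l+1+d-1)+1 := by omega
    have e' : l + 1 + d - 1 = l + d := by omega
    unfold PP
    rw [e, e', Nat.factorial_succ, Nat.factorial_succ]
    push_cast
    rw [ha, hx, hdp]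
    field_simp
    ring
  rw [hP]
  have hPP : 0 ≤ PP d (l+1) := by unfold PP; positivity
  push_cast at h1 ⊢
  rw [hdp] at h1 ⊢
  have q1 : ((l:ℝ)+1)*((l:ℝ)+1+(2*p+2)-1) = a + x := by rw [ha, hx]; ring
  have q2 : (l:ℝ)*((l:ℝ)+(2*p+2)-1) = a - x := by rw [ha, hx]; ring
  have q3 : ((l:ℝ)+1+1)*((l:ℝ)+1+1+2*p-1) = a + 2*p + x := by rw [ha, hx]; ring
  have q4 : ((l:ℝ)+1)*((l:ℝ)+1+2*p-1) = a + 2*p - x := by rw [ha, hx]; ring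
  have q5 : (2*p+2)/2+2 = p + 3 := by ring
  have q7 : (l:ℝ)^2+(2*p+2)*l+(2*p+2)/2 = a := by rw [ha, hx]; ring
  have q8 : (l:ℝ)+(2*p+2)/2 = x := by rw [hx]; ring
  have q9 : ((l:ℝ)+1)^2+(2*p)*(l+1)+p = a + 2*p := by rw [ha, hx]; ring
  have q10 : (l:ℝ)+1+p = x := by rw [hx]; ring
  rw [q1, q2, q5, q7, q8]
  rw [q3, q4, q9, q10] at h1
  refine s.trans ?_
  have hap : 0 < a := by linarith
  have hpp : 0 < p := by linarith
  have := mul_le_mul_of_nonneg_left h1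
    (by positivity : 0 ≤ (p+3) * (a*(a+p)/(a+2*p)/(p+2)))
  refine this.trans (le_of_eq ?_)
  field_simp

lemma key_four : Key 4 := by
  intro l
  have e1 : ((4:ℕ):ℝ)/2+2 = ((4:ℕ):ℝ) := by norm_num
  have hP : PP 4 l = (2*(l:ℝ)+4) * ((l+1)*(l+2)*(l+3)) / 2 := by
    unfold PP
    have : l + 4 - 1 = l + 1 + 1 + 1 := by omega
    rw [this, Nat.factorial_succ, Nat.factorial_succ, Nat.factorial_succ]
    push_cast
    field_simp
    ring
  rw [e1, Real.rpow_natCast, Real.rpow_natCast, hP]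
  have hl : (0:ℝ) ≤ l := by positivity
  push_cast
  rw [← sub_nonneg]
  ring_nf
  positivity

lemma key_three_aux (l s t : ℝ) (hl : 0 ≤ l) (hs : 0 ≤ s) (ht : 0 ≤ t)
    (hs2 : s^2 = (l*(l+2))^7) (ht2 : t^2 = ((l+1)*(l+3))^7) (h01 : l = 0 ∨ 1 ≤ l) :
    t ≤ s + 7 * (l^2+3*l+3/2) * (l+3/2) * ((l+3/2)*(l+1)*(l+2)) := by
  set Q : ℝ := 7 * (l^2+3*l+3/2) * (l+3/2) * ((l+3/2)*(l+1)*(l+2)) with hQ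
  have hQ0 : 0 < Q := by positivity
  have key : ((l+1)*(l+3))^7 - (l*(l+2))^7 - Q^2 ≤ 2 * Q * s := by
    rcases h01 with h | h
    · have : 0 ≤ 2*Q*s := by positivity
      refine le_trans ?_ this
      rw [hQ, h]; norm_num
    · refine (le_abs_self _).trans (abs_le_of_sq_le_sq ?_ (by positivity))
      rw [mul_pow (2*Q) s, hs2]
      obtain ⟨m, rfl⟩ : ∃ m, l = m + 1 := ⟨l - 1, by ring⟩
      have hm : 0 ≤ m := by linarith
      rw [hQ, ← sub_nonneg]
      ring_nf
      positivity
  refine (le_abs_self _).trans (abs_le_of_sq_le_sq ?_ (by positivity))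
  rw [ht2, add_sq, hs2]
  linarith

lemma key_three : Key 3 := by
  intro l
  have e1 : ((3:ℕ):ℝ)/2+2 = 7/2 := by norm_num
  have hP : PP 3 l = ((l:ℝ)+3/2) * (l+1)*(l+2) := by
    unfold PP
    have : l + 3 - 1 = l + 1 + 1 := by omega
    rw [this, Nat.factorial_succ, Nat.factorial_succ]
    push_cast
    field_simp
    ring
  have sq : ∀ y : ℝ, 0 ≤ y → (y^((7:ℝ)/2))^2 = y^7 := by
    intro y hy
    rw [← Real.rpow_natCast, ← Real.rpow_natCast, ← Real.rpow_mul hy]; norm_num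
  have hl : (0:ℝ) ≤ l := by positivity
  have h01 : (l:ℝ) = 0 ∨ 1 ≤ (l:ℝ) := by
    rcases Nat.eq_zero_or_pos l with h | h
    · left; exact_mod_cast h
    · right; exact_mod_cast h
  have := key_three_aux l (((l:ℝ)*(l+2))^((7:ℝ)/2)) ((((l:ℝ)+1)*(l+3))^((7:ℝ)/2)) hl
    (by positivity) (by positivity) (sq _ (by positivity)) (sq _ (by positivity)) h01
  rw [e1, hP]
  push_cast
  have q1 : (l:ℝ) + 1 + 3 - 1 = l + 3 := by ring
  have q2 : (l:ℝ) + 3 - 1 = l + 2 := by ring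
  rw [q1, q2]
  linarith

lemma key_all : ∀ d : ℕ, 3 ≤ d → Key d
  | 0, h => by omega
  | 1, h => by omega
  | 2, h => by omega
  | 3, _ => key_three
  | 4, _ => key_four
  | (n+5), _ => key_step (n+3) (by omega) (key_all (n+3) (by omega))

lemma sum_mult_succ (d l : ℕ) :
    ∑ k ∈ Finset.range (l+2), sphereMult d k
      = (Nat.choose (d+(l+1)) (l+1) : ℝ) + (Nat.choose (d+l) l : ℝ) := by
  induction l with
  | zero => simp [Finset.sum_range_succ, sphereMult]; ring
  | succ n ih =>
    rw [Finset.sum_range_succ, ih]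
    simp only [sphereMult]
    rw [if_pos (by omega)]
    have e1 : d + (n+2) - 2 = d + n := by omega
    have e2 : n + 2 - 2 = n := by omega
    rw [e1, e2]
    ring

lemma choose_real (d l : ℕ) :
    (Nat.choose (d+l) l : ℝ) = ((d+l).factorial : ℝ) / ((d.factorial : ℝ) * (l.factorial : ℝ)) := by
  have h := Nat.add_choose_mul_factorial_mul_factorial d l
  have h' : (Nat.choose (d+l) l : ℝ) * (d.factorial : ℝ) * (l.factorial : ℝ)
    = ((d+l).factorial : ℝ) := by exact_mod_cast h
  rw [← h']
  field_simp

lemma sum_mult (d l : ℕ) (hd : 1 ≤ d) :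
    ∑ k ∈ Finset.range (l+1), sphereMult d k = 2 * PP d l / (d.factorial : ℝ) := by
  obtain ⟨e, rfl⟩ : ∃ e, d = e + 1 := ⟨d - 1, by omega⟩
  cases l with
  | zero =>
    simp [sphereMult, PP, Nat.factorial_succ]
    field_simp
  | succ n =>
    rw [sum_mult_succ, choose_real, choose_real]
    unfold PP
    have e1 : e + 1 + (n+1) = (e + n + 1) + 1 := by omega
    have e2 : e + 1 + n = e + n + 1 := by omega
    have e3 : n + 1 + (e+1) - 1 = e + n + 1 := by omega
    rw [e1, e2, e3, Nat.factorial_succ (e+n+1), Nat.factorial_succ n]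
    push_cast
    field_simp
    ring

lemma sphereMult_nonneg (d l : ℕ) : 0 ≤ sphereMult d l := by
  unfold sphereMult
  split_ifs with h
  · obtain ⟨n, rfl⟩ : ∃ n, l = n + 2 := ⟨l - 2, by omega⟩
    have e1 : d + (n+2) - 2 = d + n := by omega
    have e2 : n + 2 - 2 = n := by omega
    rw [e1, e2, sub_nonneg]
    rw [← Nat.choose_symm_add, ← Nat.choose_symm_add]
    exact_mod_cast Nat.choose_le_choose d (by omega)
  · simp

noncomputable def lam (d l : ℕ) : ℝ := (l:ℝ) * ((l:ℝ) + (d:ℝ) - 1)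

lemma lam_nonneg (d l : ℕ) (hd : 3 ≤ d) : 0 ≤ lam d l := by
  have hd' : (3:ℝ) ≤ d := by exact_mod_cast hd
  have hl : (0:ℝ) ≤ l := by positivity
  unfold lam
  apply mul_nonneg hl; linarith

lemma lam_mono (d : ℕ) (hd : 3 ≤ d) : Monotone (lam d) := by
  apply monotone_nat_of_le_succ
  intro l
  have hd' : (3:ℝ) ≤ d := by exact_mod_cast hd
  have hl : (0:ℝ) ≤ l := by positivity
  unfold lam
  push_cast
  nlinarith

lemma le_lam (d l : ℕ) (hd : 3 ≤ d) : (l:ℝ) ≤ lam d l := by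
  have hd' : (3:ℝ) ≤ d := by exact_mod_cast hd
  have hl : (0:ℝ) ≤ l := by positivity
  unfold lam
  nlinarith

/-- the bound at the eigenvalues -/
lemma node_bound (d : ℕ) (hd : 3 ≤ d) (L : ℕ) :
    8 / (((d : ℝ) + 4) * (Nat.factorial d : ℝ)) * (lam d L) ^ ((d:ℝ)/2+2) ≤
      ∑ l ∈ Finset.range L, sphereMult d l * ((lam d L)^2 - (lam d l)^2) := by
  have hd' : (3:ℝ) ≤ d := by exact_mod_cast hd
  induction L with
  | zero =>
    have : lam d 0 = 0 := by simp [lam]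
    rw [this, Real.zero_rpow (by positivity)]
    simp
  | succ n ih =>
    have hk := key_all d hd n
    have e : ∑ l ∈ Finset.range (n+1), sphereMult d l * ((lam d (n+1))^2 - (lam d l)^2)
      = ∑ l ∈ Finset.range n, sphereMult d l * ((lam d n)^2 - (lam d l)^2)
        + (∑ l ∈ Finset.range (n+1), sphereMult d l) * ((lam d (n+1))^2 - (lam d n)^2) := by
      have : ∑ l ∈ Finset.range n, sphereMult d l * ((lam d n)^2 - (lam d l)^2)
        = ∑ l ∈ Finset.range (n+1), sphereMult d l * ((lam d n)^2 - (lam d l)^2) := by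
        rw [Finset.sum_range_succ]; simp
      rw [this, Finset.sum_mul, ← Finset.sum_add_distrib]
      apply Finset.sum_congr rfl
      intros; ring
    rw [e, sum_mult d n (by omega)]
    have l1 : ((n:ℝ)+1)*((n:ℝ)+1+d-1) = lam d (n+1) := by simp [lam]
    have l2 : (n:ℝ)*((n:ℝ)+d-1) = lam d n := rfl
    rw [l1, l2] at hk
    have hf : (lam d (n+1))^2 - (lam d n)^2 = 4 * ((n:ℝ)^2+d*n+d/2) * (n+d/2) := by
      simp only [lam]; push_cast; ring
    have hc : 0 ≤ 8 / (((d : ℝ) + 4) * (Nat.factorial d : ℝ)) := by positivity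
    have := mul_le_mul_of_nonneg_left hk hc
    have e2 : 8 / (((d : ℝ) + 4) * (Nat.factorial d : ℝ)) *
      (((d:ℝ)/2+2) * (2 * ((n:ℝ)^2+d*n+d/2) * (n+d/2)) * PP d n)
      = 2 * PP d n / (d.factorial : ℝ) * ((lam d (n+1))^2 - (lam d n)^2) := by
      rw [hf]; field_simp; ring
    rw [e2, mul_sub] at this
    linarith

theorem riesz_mean_biharmonic_sphere_lower_bound (d : ℕ) (hd : 3 ≤ d) (z : ℝ) (hz : 0 ≤ z) :
    R1biharmSd d z ≥ 8 / (((d : ℝ) + 4) * (Nat.factorial d : ℝ)) * z ^ (1 + (d : ℝ) / 4) := by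
  have hd' : (3:ℝ) ≤ d := by exact_mod_cast hd
  -- choose L with lam_L ^ 2 ≤ z < lam_{L+1} ^ 2
  obtain ⟨M, hM⟩ : ∃ M : ℕ, z < (lam d M)^2 := by
    obtain ⟨M, hM⟩ := exists_nat_gt (z + 1)
    refine ⟨M, ?_⟩
    have := le_lam d M hd
    nlinarith
  classical
  have hex : ∃ M : ℕ, z < (lam d M)^2 := ⟨M, hM⟩
  obtain ⟨L, hL⟩ : ∃ L, Nat.find hex = L + 1 := by
    apply Nat.exists_eq_succ_of_ne_zero
    intro h
    have := Nat.find_spec hex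
    rw [h] at this
    simp [lam] at this
    linarith
  have h2 : z < (lam d (L+1))^2 := by rw [← hL]; exact Nat.find_spec hex
  have h1 : (lam d L)^2 ≤ z := not_lt.1 (Nat.find_min hex (by omega))
  have hlow : ∑ l ∈ Finset.range (L+1), sphereMult d l * (z - (lam d l)^2) ≤ R1biharmSd d z := by
    unfold R1biharmSd
    have hs : ∀ l ∉ Finset.range (L+1),
        sphereMult d l * max (z - ((l : ℝ) * ((l : ℝ) + (d : ℝ) - 1)) ^ 2) 0 = 0 := by
      intro l hl
      rw [Finset.mem_range, not_lt] at hl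
      have h3 : lam d (L+1) ≤ lam d l := lam_mono d hd hl
      have h4 := lam_nonneg d (L+1) hd
      have h5 : (lam d (L+1))^2 ≤ (lam d l)^2 := by gcongr
      rw [max_eq_right, mul_zero]
      change z - (lam d l)^2 ≤ 0
      linarith
    rw [tsum_eq_sum hs]
    apply Finset.sum_le_sum
    intro l _
    exact mul_le_mul_of_nonneg_left (le_max_left _ _) (sphereMult_nonneg d l)
  refine ge_iff_le.2 (le_trans ?_ hlow)
  have hc : 0 ≤ 8 / (((d : ℝ) + 4) * (Nat.factorial d : ℝ)) := by positivity
  set c := 8 / (((d : ℝ) + 4) * (Nat.factorial d : ℝ)) with hcdef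
  have hpow : ∀ l, ((lam d l)^2) ^ (1 + (d:ℝ)/4) = (lam d l) ^ ((d:ℝ)/2+2) := by
    intro l
    rw [← Real.rpow_natCast, ← Real.rpow_mul (lam_nonneg d l hd)]
    congr 1; push_cast; ring
  have b1 := node_bound d hd L
  have b2 := node_bound d hd (L+1)
  rw [← hcdef, ← hpow] at b1 b2
  have b1' : c * ((lam d L)^2) ^ (1 + (d:ℝ)/4) ≤
      ∑ l ∈ Finset.range (L+1), sphereMult d l * ((lam d L)^2 - (lam d l)^2) := by
    rw [Finset.sum_range_succ]; simpa using b1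
  have hconv := convexOn_rpow (p := 1 + (d:ℝ)/4) (by linarith)
  set A := (lam d L)^2
  set B := (lam d (L+1))^2
  have hAB : 0 < B - A := by linarith
  have hA : 0 ≤ A := sq_nonneg _
  set s := (B - z)/(B - A) with hs
  set t := (z - A)/(B - A) with ht
  have hs0 : 0 ≤ s := div_nonneg (by linarith) hAB.le
  have ht0 : 0 ≤ t := div_nonneg (by linarith) hAB.le
  have hst : s + t = 1 := by rw [hs, ht]; field_simp; ring
  have hz' : s * A + t * B = z := by rw [hs, ht]; field_simp; ring
  have hj := hconv.2 (Set.mem_Ici.2 hA) (Set.mem_Ici.2 (by linarith : 0 ≤ B)) hs0 ht0 hst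
  simp only [smul_eq_mul] at hj
  rw [hz'] at hj
  have hlin : ∑ l ∈ Finset.range (L+1), sphereMult d l * (z - (lam d l)^2)
      = s * ∑ l ∈ Finset.range (L+1), sphereMult d l * (A - (lam d l)^2)
        + t * ∑ l ∈ Finset.range (L+1), sphereMult d l * (B - (lam d l)^2) := by
    rw [Finset.mul_sum, Finset.mul_sum, ← Finset.sum_add_distrib]
    apply Finset.sum_congr rfl
    intro l _
    have ht' : t = 1 - s := by linarith
    rw [← hz', ht']; ring
  rw [hlin]
  calc c * z ^ (1 + (d:ℝ)/4) ≤ c * (s * A ^ (1 + (d:ℝ)/4) + t * B ^ (1 + (d:ℝ)/4)) := by gcongr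
    _ = s * (c * A ^ (1 + (d:ℝ)/4)) + t * (c * B ^ (1 + (d:ℝ)/4)) := by ring
    _ ≤ _ := by gcongr
end
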